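/- Let ℬ be a locally finitely presentable category and B an object of ℬ. Then the coslice B↓ℬ is locally finitely presentable, and its full subcategory of finitely presented objects is equivalent to 𝒢_B, the category of arrows B → C arising as a pushout of a morphism between finitely presented objects of ℬ along a map into B. -/

import Mathlib

open CategoryTheory Limits Opposite

universe w v u

section Defs

variable {𝒞 : Type u} [Category.{v} 𝒞]

/-- An object `K` is finitely presented if `Hom(K, -)` preserves filtered colimits. -/
def IsFinPres (K : 𝒞) : Prop :=
  ∀ (J : Type v) (_ : SmallCategory J) (_ : IsFiltered J),
    Nonempty (PreservesColimitsOfShape J (coyoneda.obj (op K)))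

/-- A category is locally finitely presentable if it is cocomplete and admits an essentially
small family of finitely presented objects such that every object is a filtered colimit of
objects of this family. -/
class IsLFP (𝒞 : Type u) [Category.{v} 𝒞] extends HasColimits 𝒞 : Prop where
  exists_gen : ∃ S : Set 𝒞, Small.{v} S ∧ (∀ K ∈ S, IsFinPres K) ∧
    ∀ X : 𝒞, ∃ (J : Type v) (_ : SmallCategory J) (_ : IsFiltered J)
      (D : J ⥤ 𝒞) (c : Cocone D) (_ : Nonempty (IsColimit c)),
      c.pt = X ∧ ∀ j, D.obj j ∈ S

/-- `l : X ⟶ Y` belongs to the coslice generator `𝒢_X`: it is a pushout of a morphism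
between finitely presented objects along a map into `X`. -/
def InGen {X Y : 𝒞} (l : X ⟶ Y) : Prop :=
  ∃ (K K' : 𝒞) (_ : IsFinPres K) (_ : IsFinPres K') (k : K ⟶ K') (a : K ⟶ X)
    (c : K' ⟶ Y), IsPushout a k l c

end Defs

attribute [local instance] Cardinal.fact_isRegular_aleph0

section FinitelyPresented

variable {𝒞 : Type u} [Category.{v} 𝒞]

theorem isFinPres_iff_isFinitelyPresentable {K : 𝒞} :
    IsFinPres K ↔ IsFinitelyPresentable.{v} K := by
  rw [isFinitelyPresentable_iff_preservesFilteredColimits]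
  exact ⟨fun h => ⟨fun J _ _ => (h J _ ‹_›).some⟩,
    fun h J _ _ => ⟨h.preserves_filtered_colimits J⟩⟩

theorem isLFP_iff_isLocallyFinitelyPresentable :
    IsLFP 𝒞 ↔ IsLocallyFinitelyPresentable.{v} 𝒞 := by
  constructor
  · intro h
    obtain ⟨S, hS, hS₁, hS₂⟩ := h.exists_gen
    let P : ObjectProperty 𝒞 := fun X => X ∈ S
    have : ObjectProperty.Small.{v} P := hS
    have hP : P.IsCardinalFilteredGenerator Cardinal.aleph0.{v} :=
      { le_isCardinalPresentable := fun X hX =>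
          isFinPres_iff_isFinitelyPresentable.1 (hS₁ X hX)
        exists_colimitsOfShape := fun X => by
          obtain ⟨J, _, _, D, c, ⟨hc⟩, rfl, hD⟩ := hS₂ X
          exact ⟨J, inferInstance, (isCardinalFiltered_aleph0_iff J).2 inferInstance,
            ⟨{ diag := D, ι := c.ι, isColimit := hc, prop_diag_obj := hD }⟩⟩ }
    have := hP.hasCardinalFilteredGenerator
    constructor
  · intro h
    obtain ⟨P, hP, hP'⟩ :=
      HasCardinalFilteredGenerator.exists_small_generator 𝒞 Cardinal.aleph0.{v}
    refine ⟨⟨{X | P X}, hP, fun K hK => isFinPres_iff_isFinitelyPresentable.2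
      (hP'.le_isCardinalPresentable K hK), fun X => ?_⟩⟩
    obtain ⟨J, _, hJ, ⟨p⟩⟩ := hP'.exists_colimitsOfShape X
    exact ⟨J, inferInstance, (isCardinalFiltered_aleph0_iff J).1 hJ, p.diag, _,
      ⟨p.isColimit⟩, rfl, p.prop_diag_obj⟩

theorem IsFinPres.of_isColimit {J : Type} [SmallCategory J] [FinCategory J] {D : J ⥤ 𝒞}
    {c : Cocone D} (hc : IsColimit c) (h : ∀ j, IsFinPres (D.obj j)) : IsFinPres c.pt := by
  simp only [isFinPres_iff_isFinitelyPresentable] at h ⊢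
  exact isCardinalPresentable_of_isColimit c hc Cardinal.aleph0.{v}
    (by rw [hasCardinalLT_aleph0_iff]; infer_instance)

theorem IsFinPres.of_isPushout {W X Y Z : 𝒞} {f : W ⟶ X} {g : W ⟶ Y} {h : X ⟶ Z} {i : Y ⟶ Z}
    (sq : IsPushout f g h i) (hW : IsFinPres W) (hX : IsFinPres X) (hY : IsFinPres Y) :
    IsFinPres Z :=
  IsFinPres.of_isColimit sq.isColimit (by rintro (_ | _ | _) <;> assumption)

theorem IsFinPres.coprod {X Y : 𝒞} [HasBinaryCoproduct X Y]
    (hX : IsFinPres X) (hY : IsFinPres Y) : IsFinPres (X ⨿ Y) :=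
  IsFinPres.of_isColimit (colimit.isColimit (pair X Y)) (by rintro ⟨_ | _⟩ <;> assumption)

theorem isFinPres_initial [HasInitial 𝒞] : IsFinPres (⊥_ 𝒞) :=
  IsFinPres.of_isColimit (colimit.isColimit (Functor.empty 𝒞)) (by rintro ⟨⟨⟩⟩)

/-- Objects of a coslice attached along finitely presented data are finitely presented. -/
theorem InGen.isFinPres [HasColimits 𝒞] {B : 𝒞} {l : Under B} (hl : InGen l.hom) :
    IsFinPres l := by
  obtain ⟨K, K', hK, hK', k, a, c, sq⟩ := hl
  rw [isFinPres_iff_isFinitelyPresentable] at hK hK'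
  refine fun J _ _ => ⟨⟨fun {F} => ⟨fun {s} hs => ⟨?_⟩⟩⟩⟩
  have := IsFiltered.isConnected J
  have hs' := isColimitOfPreserves (Under.forget B) hs
  refine Types.FilteredColimit.isColimitOf' _ _ (fun (f : l ⟶ s.pt) => ?_)
    (fun j (f₁ : l ⟶ F.obj j) (f₂ : l ⟶ F.obj j) hf => ?_)
  · obtain ⟨i, (p : K' ⟶ (F.obj i).right), hp⟩ :=
      IsFinitelyPresentable.exists_hom_of_isColimit hs' (c ≫ f.right)
    replace hp : p ≫ (s.ι.app i).right = c ≫ f.right := hp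
    have hs_hom : (F.obj i).hom ≫ (s.ι.app i).right = s.pt.hom := Under.w (s.ι.app i)
    obtain ⟨j, u, hu⟩ := Limits.exists_eq_of_preservesColimit_coyoneda_self hs'
      (k ≫ p) (a ≫ (F.obj i).hom) (by
        change (k ≫ p) ≫ (s.ι.app i).right = (a ≫ (F.obj i).hom) ≫ (s.ι.app i).right
        rw [Category.assoc, Category.assoc, hp, hs_hom, ← sq.w_assoc, Under.w f])
    replace hu : (k ≫ p) ≫ (F.map u).right = (a ≫ (F.obj i).hom) ≫ (F.map u).right := hu
    have hF : (F.obj i).hom ≫ (F.map u).right = (F.obj j).hom := Under.w (F.map u)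
    have hsu : (F.map u).right ≫ (s.ι.app j).right = (s.ι.app i).right := by
      rw [← Under.comp_right, s.w]
    have hw : a ≫ (F.obj j).hom = k ≫ p ≫ (F.map u).right := by
      rw [← hF, ← Category.assoc, ← hu, Category.assoc]
    refine ⟨j, Under.homMk (sq.desc (F.obj j).hom (p ≫ (F.map u).right) hw)
      (sq.inl_desc _ _ _), ?_⟩
    have hsj : (F.obj j).hom ≫ (s.ι.app j).right = s.pt.hom := Under.w (s.ι.app j)
    change f = _ ≫ s.ι.app j
    ext
    apply sq.hom_ext
    · change l.hom ≫ f.right = l.hom ≫ sq.desc _ _ _ ≫ (s.ι.app j).right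
      rw [sq.inl_desc_assoc, Under.w f, hsj]
    · change c ≫ f.right = c ≫ sq.desc _ _ _ ≫ (s.ι.app j).right
      rw [sq.inr_desc_assoc, Category.assoc, hsu, hp]
  · replace hf : f₁ ≫ s.ι.app j = f₂ ≫ s.ι.app j := hf
    obtain ⟨i, u, hu⟩ := Limits.exists_eq_of_preservesColimit_coyoneda_self hs'
      (c ≫ f₁.right) (c ≫ f₂.right) (by
        change (c ≫ f₁.right) ≫ (s.ι.app j).right = (c ≫ f₂.right) ≫ (s.ι.app j).right
        simp only [Category.assoc, ← Under.comp_right, hf])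
    replace hu : (c ≫ f₁.right) ≫ (F.map u).right = (c ≫ f₂.right) ≫ (F.map u).right := hu
    refine ⟨i, u, ?_⟩
    change f₁ ≫ F.map u = f₂ ≫ F.map u
    ext
    apply sq.hom_ext
    · rw [Under.w, Under.w]
    · simpa using hu

end FinitelyPresented

section Attach

variable {𝒞 : Type u} [Category.{v} 𝒞]

theorem InGen.of_isPushout {W X Y Z : 𝒞} {f : W ⟶ X} {g : W ⟶ Y} {h : X ⟶ Z} {i : Y ⟶ Z}
    (hg : InGen g) (sq : IsPushout f g h i) : InGen h := by
  obtain ⟨K, K', hK, hK', k, a, c, sq'⟩ := hg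
  exact ⟨K, K', hK, hK', k, a ≫ f, c ≫ i, sq'.paste_horiz sq⟩

theorem InGen.of_isIso [HasInitial 𝒞] {X Y : 𝒞} (l : X ⟶ Y) [IsIso l] : InGen l :=
  ⟨⊥_ 𝒞, ⊥_ 𝒞, isFinPres_initial, isFinPres_initial, 𝟙 _, initial.to X, initial.to Y,
    IsPushout.of_vert_isIso ⟨by simp⟩⟩

/-- Given a pushout square along `p.ι.app j₀` into a filtered colimit, a map from a finitely
presented object into the pushout factors through some finite stage. -/
theorem exists_hom_pushout_stage [HasColimits 𝒞] {J : Type v} [SmallCategory J] [IsFiltered J]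
    {B : 𝒞} (p : ColimitPresentation J B) {j₀ : J} {K C : 𝒞} {k : p.diag.obj j₀ ⟶ K}
    {l : B ⟶ C} {c : K ⟶ C} (sq : IsPushout (p.ι.app j₀) k l c)
    {M : 𝒞} (hM : IsFinPres M) (g : M ⟶ C) :
    ∃ (j : J) (u : j₀ ⟶ j) (m : M ⟶ pushout (p.diag.map u) k),
      m ≫ (IsPushout.of_hasPushout (p.diag.map u) k).desc (p.ι.app j ≫ l) c (by
        rw [← Category.assoc, p.w, sq.w]) = g := by
  rw [isFinPres_iff_isFinitelyPresentable] at hM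
  have hc := isColimitOfPreserves (Under.forget _) (isColimitOfPreserves (Under.pushout k)
    (p.isColimit.underPost j₀))
  obtain ⟨j, (m : M ⟶ pushout (p.diag.map j.hom) k), hm⟩ :=
    IsFinitelyPresentable.exists_hom_of_isColimit hc (g ≫ sq.isoPushout.hom)
  replace hm : m ≫ pushout.desc (p.ι.app j.right ≫ pushout.inl _ _) (pushout.inr _ _) _ =
    g ≫ sq.isoPushout.hom := hm
  refine ⟨j.right, j.hom, m, ?_⟩
  rw [← cancel_mono sq.isoPushout.hom, ← hm, Category.assoc]
  congr 1
  apply pushout.hom_ext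
  · refine ((IsPushout.of_hasPushout (p.diag.map j.hom) k).inl_desc_assoc _ _ _ _).trans ?_
    refine .trans ?_ (pushout.inl_desc _ _ _).symm
    rw [Category.assoc, sq.inl_isoPushout_hom]
  · refine ((IsPushout.of_hasPushout (p.diag.map j.hom) k).inr_desc_assoc _ _ _ _).trans ?_
    exact sq.inr_isoPushout_hom.trans (pushout.inr_desc _ _ _).symm

theorem InGen.comp [IsLFP 𝒞] {X Y Z : 𝒞} {f : X ⟶ Y} {g : Y ⟶ Z} (hf : InGen f) (hg : InGen g) :
    InGen (f ≫ g) := by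
  obtain ⟨S, -, hS, hS'⟩ := IsLFP.exists_gen (𝒞 := 𝒞)
  obtain ⟨J, _, _, D, s, ⟨hs⟩, rfl, hD⟩ := hS' X
  let p : ColimitPresentation J s.pt := { diag := D, ι := s.ι, isColimit := hs }
  have hp (j : J) : IsFinPres (p.diag.obj j) := hS _ (hD j)
  obtain ⟨K, K', hK, hK', k, a, c, sq⟩ := hf
  obtain ⟨M, N, hM, hN, n, b, d, sq'⟩ := hg
  obtain ⟨j₀, a₀, rfl⟩ : ∃ (j₀ : J) (a₀ : K ⟶ p.diag.obj j₀), a₀ ≫ p.ι.app j₀ = a := by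
    rw [isFinPres_iff_isFinitelyPresentable] at hK
    exact IsFinitelyPresentable.exists_hom_of_isColimit hs a
  have sq₀ := IsPushout.of_hasPushout a₀ k
  have sq₁ := IsPushout.of_left' sq sq₀
  obtain ⟨j, u, m, rfl⟩ := exists_hom_pushout_stage p sq₁ hM b
  have sq₂ := IsPushout.of_hasPushout (p.diag.map u) (pushout.inl a₀ k)
  have sq₃ := IsPushout.of_hasPushout m n
  have sq₄ := IsPushout.of_left' sq' sq₃
  have sq₅ := IsPushout.of_left' (h₁₂ := p.ι.app j) (by rwa [p.w]) sq₂
  have hP := IsFinPres.of_isPushout sq₂ (hp j₀) (hp j)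
    (IsFinPres.of_isPushout sq₀ hK (hp j₀) hK')
  exact ⟨_, _, hp j, IsFinPres.of_isPushout sq₃ hM hP hN, _, _, _, sq₅.paste_vert sq₄⟩

theorem InGen.of_comp [IsLFP 𝒞] {X Y Z : 𝒞} {f : X ⟶ Y} {g : Y ⟶ Z}
    (hf : InGen f) (hfg : InGen (f ≫ g)) : InGen g := by
  have h₁ : InGen (pushout.inl f (f ≫ g)) :=
    hfg.of_isPushout (IsPushout.of_hasPushout f (f ≫ g))
  have h₂ : InGen (pushout.desc g (𝟙 Z) (by simp) : pushout f (f ≫ g) ⟶ Z) := by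
    obtain ⟨K, K', hK, hK', k, a, c, sq⟩ := hf
    refine ⟨K' ⨿ K', K', hK'.coprod hK', hK', coprod.desc (𝟙 _) (𝟙 _),
      coprod.desc (c ≫ pushout.inl _ _) (c ≫ g ≫ pushout.inr _ _), c ≫ g, ⟨?_⟩, ⟨?_⟩⟩
    · ext <;> simp [pushout.inl_desc, pushout.inr_desc]
    · refine PushoutCocone.IsColimit.mk _ (fun s => pushout.inr _ _ ≫ s.inl) (fun s => ?_)
        (fun s => ?_) (fun s m hm₁ hm₂ => ?_)
      · have h₁ := coprod.inl ≫= s.condition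
        have h₂ := coprod.inr ≫= s.condition
        simp only [coprod.inl_desc_assoc, coprod.inr_desc_assoc, Category.assoc,
          Category.id_comp] at h₁ h₂
        apply pushout.hom_ext
        · rw [pushout.inl_desc_assoc]
          apply sq.hom_ext
          · rw [pushout.condition_assoc, Category.assoc]
          · rw [h₁, h₂]
        · rw [pushout.inr_desc_assoc, Category.id_comp]
      · have h₂ := coprod.inr ≫= s.condition
        simp only [coprod.inr_desc_assoc, Category.assoc, Category.id_comp] at h₂
        rw [Category.assoc, h₂]
      · rw [← hm₁, pushout.inr_desc_assoc, Category.id_comp]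
  simpa [pushout.inl_desc] using h₁.comp h₂

/-- The objects of the coslice `B ↓ 𝒞` which are attached along finitely presented data. -/
def attachable (B : 𝒞) : ObjectProperty (Under B) := fun l => InGen l.hom

variable [IsLFP 𝒞] (B : 𝒞)

instance : (attachable B).IsClosedUnderIsomorphisms where
  of_iso {l l'} e (hl : InGen l.hom) := by
    have : IsIso e.hom.right := inferInstanceAs (IsIso ((Under.forget B).map e.hom))
    have := hl.comp (InGen.of_isIso e.hom.right)
    rwa [Under.w] at this

theorem attachable_of_isInitial {l : Under B} (hl : IsInitial l) : attachable B l :=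
  ObjectProperty.prop_of_iso _ (Under.mkIdInitial.uniqueUpToIso hl) (InGen.of_isIso (𝟙 B))

theorem attachable_of_isPushout {W X Y Z : Under B} {f : W ⟶ X} {g : W ⟶ Y} {h : X ⟶ Z}
    {i : Y ⟶ Z} (sq : IsPushout f g h i) (hW : attachable B W) (hX : attachable B X)
    (hY : attachable B Y) : attachable B Z := by
  have hg : InGen g.right := InGen.of_comp (f := W.hom) hW (by rwa [Under.w])
  have hh : InGen h.right := hg.of_isPushout (sq.map (Under.forget B))
  have := InGen.comp hX hh
  rwa [Under.w] at this

instance : (attachable B).IsClosedUnderColimitsOfShape (Discrete.{0} PEmpty) where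
  colimitsOfShape_le := by
    rintro l ⟨p⟩
    exact attachable_of_isInitial B (isColimitEquivIsInitialOfIsEmpty _ _ p.isColimit)

instance : (attachable B).IsClosedUnderColimitsOfShape WalkingSpan where
  colimitsOfShape_le := by
    rintro l ⟨p⟩
    exact attachable_of_isPushout B (IsPushout.of_isColimit_cocone p.isColimit)
      (p.prop_diag_obj _) (p.prop_diag_obj _) (p.prop_diag_obj _)

theorem attachable_isClosedUnderColimitsOfShape (J : Type w) [SmallCategory J] [FinCategory J] :
    (attachable B).IsClosedUnderColimitsOfShape J := by
  have : (attachable B).IsClosedUnderColimitsOfShape (FinCategory.AsType J) := by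
    refine ⟨fun l ⟨p⟩ => ?_⟩
    have := createsFiniteColimitsOfCreatesInitialAndPushouts (attachable B).ι
    have := this.createsFiniteColimits (FinCategory.AsType J)
    let F := (attachable B).lift p.diag p.prop_diag_obj
    have hF : IsColimit (C := Under B) (F := F ⋙ (attachable B).ι) ⟨l, p.ι⟩ := p.isColimit
    exact (attachable B).prop_of_iso ((Cocone.forget _).mapIso (liftedColimitMapsToOriginal hF))
      (liftColimit hF).pt.property
  exact .of_equivalence (FinCategory.equivAsType J)

/-- The object of `B ↓ 𝒞` freely generated by an object `K` of `𝒞`. -/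
noncomputable abbrev freeUnder (K : 𝒞) : Under B := Under.mk (coprod.inl : B ⟶ B ⨿ K)

variable {B} in
/-- Morphisms out of the free object `B ⟶ B ⨿ K` are determined by morphisms out of `K`. -/
noncomputable def freeUnderDesc {K : 𝒞} {l : Under B} (f : K ⟶ l.right) :
    freeUnder B K ⟶ l :=
  Under.homMk (coprod.desc l.hom f) (coprod.inl_desc _ _)

variable {B} in
theorem inr_freeUnderDesc_right {K : 𝒞} {l : Under B} (f : K ⟶ l.right) :
    (coprod.inr : K ⟶ B ⨿ K) ≫ (freeUnderDesc f).right = f :=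
  coprod.inr_desc _ _

variable {B} in
theorem inr_freeUnderDesc_comp_right {K : 𝒞} {l l' : Under B} (f : K ⟶ l.right) (i : l ⟶ l') :
    (coprod.inr : K ⟶ B ⨿ K) ≫ (freeUnderDesc f ≫ i).right = f ≫ i.right := by
  rw [Under.comp_right, ← Category.assoc, inr_freeUnderDesc_right]

variable {B} in
theorem freeUnder_hom_ext {K : 𝒞} {l : Under B} {f g : freeUnder B K ⟶ l}
    (h : (coprod.inr : K ⟶ B ⨿ K) ≫ f.right = coprod.inr ≫ g.right) : f = g := by
  ext
  refine coprod.hom_ext ?_ h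
  exact (Under.w f).trans (Under.w g).symm

theorem attachable_freeUnder {K : 𝒞} (hK : IsFinPres K) : attachable B (freeUnder B K) := by
  refine ⟨⊥_ 𝒞, K, isFinPres_initial, hK, initial.to K, initial.to B, coprod.inr,
    ⟨by simp⟩, ⟨?_⟩⟩
  exact PushoutCocone.IsColimit.mk _ (fun s => coprod.desc s.inl s.inr)
    (fun s => coprod.inl_desc _ _) (fun s => coprod.inr_desc _ _)
    (fun s m hm₁ hm₂ => coprod.hom_ext (hm₁.trans (coprod.inl_desc _ _).symm)
      (hm₂.trans (coprod.inr_desc _ _).symm))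

theorem isStrongGenerator_freeUnder {P : ObjectProperty 𝒞} (hP : P.IsStrongGenerator) :
    (ObjectProperty.ofObj fun K : Subtype P => freeUnder B K.1).IsStrongGenerator := by
  have hsep : (ObjectProperty.ofObj fun K : Subtype P => freeUnder B K.1).IsSeparating := by
    intro X Y f g hfg
    ext
    refine hP.isSeparating _ _ fun K hK a => ?_
    have h := hfg _ (ObjectProperty.ofObj_apply _ ⟨K, hK⟩) (freeUnderDesc a)
    rw [← inr_freeUnderDesc_comp_right, h, inr_freeUnderDesc_comp_right]
  refine ObjectProperty.isStrongGenerator_iff.2 ⟨hsep, fun X Y i _ hi => ?_⟩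
  have hmono : Mono i.right := by
    refine (hP.isSeparating.mono_iff _).2 fun K hK a b hab => ?_
    have h : freeUnderDesc a ≫ i = freeUnderDesc b ≫ i := freeUnder_hom_ext (by
      rw [inr_freeUnderDesc_comp_right, inr_freeUnderDesc_comp_right, hab])
    rw [cancel_mono] at h
    rw [← inr_freeUnderDesc_right a, h, inr_freeUnderDesc_right]
  have : IsIso i.right := by
    refine hP.isIso_of_mono _ fun K hK a => ?_
    obtain ⟨b, hb⟩ := hi _ (ObjectProperty.ofObj_apply _ ⟨K, hK⟩) (freeUnderDesc a)
    have hb' : b ≫ i = freeUnderDesc a := hb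
    refine ⟨coprod.inr ≫ b.right, ?_⟩
    change (coprod.inr ≫ b.right) ≫ i.right = a
    rw [Category.assoc, ← Under.comp_right, hb', inr_freeUnderDesc_right]
  have : IsIso ((Under.forget B).map i) := this
  exact isIso_of_reflects_iso i (Under.forget B)

end Attach

/-- For `ℬ` locally finitely presentable and `B : ℬ`, the coslice `B↓ℬ` is locally finitely
presentable, and its finitely presented objects are exactly the objects of `𝒢_B`, i.e. the
arrows `B ⟶ C` arising as pushouts of morphisms between finitely presented objects of `ℬ`
along a map into `B`. -/
theorem stmt12 {ℬ : Type u} [Category.{v} ℬ] [IsLFP ℬ] (B : ℬ) :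
    IsLFP (Under B) ∧ ∀ l : Under B, IsFinPres l ↔ InGen l.hom := by
  have := isLFP_iff_isLocallyFinitelyPresentable.1 ‹IsLFP ℬ›
  obtain ⟨P, _, hP, hP'⟩ := (IsCardinalLocallyPresentable.iff_exists_isStrongGenerator
    ℬ Cardinal.aleph0.{v}).1 this
  have hgen := isStrongGenerator_freeUnder B hP
  have hle : (ObjectProperty.ofObj fun K : Subtype P => freeUnder B K.1) ≤ attachable B := by
    rw [ObjectProperty.ofObj_le_iff]
    exact fun K => attachable_freeUnder B (isFinPres_iff_isFinitelyPresentable.2 (hP' _ K.2))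
  have hle' := hle.trans fun l (hl : InGen l.hom) =>
    (isFinPres_iff_isFinitelyPresentable.1 hl.isFinPres :
      isCardinalPresentable (Under B) Cardinal.aleph0.{v} l)
  refine ⟨isLFP_iff_isLocallyFinitelyPresentable.2
    ((IsCardinalLocallyPresentable.iff_exists_isStrongGenerator _ _).2
      ⟨_, inferInstance, hgen, hle'⟩), fun l => ⟨fun hl => ?_, InGen.isFinPres⟩⟩
  rw [isFinPres_iff_isFinitelyPresentable] at hl
  refine ObjectProperty.colimitsCardinalClosure_le _ Cardinal.aleph0.{v} (Q := attachable B)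
    (fun J _ hJ => ?_) hle l ?_
  · rw [hasCardinalLT_aleph0_iff, Arrow.finite_iff] at hJ
    obtain ⟨_⟩ := hJ
    exact attachable_isClosedUnderColimitsOfShape B J
  · rw [← IsStrongGenerator.colimitsCardinalClosure_eq_isCardinalPresentable hgen hle']
    exact hl
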